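/- arXiv:1307.1101 — 8 statements merged into one kernel-verified Lean document; each statement's English description precedes it below -/
import Mathlib

section
/- Suppose (W*, U*, V*) is MSE-feasible and P(V*) ≤ P(V) holds for every MSE-feasible triple (W, U, V). Then V* is rate-feasible, and P(V*) ≤ P(V) holds for every rate-feasible precoder family V. -/
open Matrix ComplexOrder

namespace Matrix

variable {m n : Type*} [Fintype m] [Fintype n] [DecidableEq m] [DecidableEq n]

theorem PosDef.card_add_log_det_le_trace {X : Matrix n n ℂ} (hX : X.PosDef) :
    (Fintype.card n : ℝ) + Real.log X.det.re ≤ X.trace.re := by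
  have hdet : X.det.re = ∏ i, hX.1.eigenvalues i := by
    rw [hX.1.det_eq_prod_eigenvalues]
    exact_mod_cast Complex.ofReal_re _
  have htr : X.trace.re = ∑ i, hX.1.eigenvalues i := by
    rw [hX.1.trace_eq_sum_eigenvalues]
    exact_mod_cast Complex.ofReal_re _
  rw [hdet, htr, Real.log_prod fun i _ => (hX.eigenvalues_pos i).ne']
  have hcard : (Fintype.card n : ℝ) = ∑ _i : n, (1 : ℝ) := by simp
  rw [hcard, ← Finset.sum_add_distrib]
  refine Finset.sum_le_sum fun i _ => ?_
  linarith [Real.log_le_sub_one_of_pos (hX.eigenvalues_pos i)]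

theorem PosDef.det_re_pos {X : Matrix n n ℂ} (hX : X.PosDef) : 0 < X.det.re :=
  (Complex.pos_iff.1 hX.det_pos).1

theorem PosDef.det_re_mul {X Y : Matrix n n ℂ} (hX : X.PosDef) :
    (X.det * Y.det).re = X.det.re * Y.det.re := by
  rw [Complex.mul_re, ← (Complex.pos_iff.1 hX.det_pos).2, zero_mul, sub_zero]

open scoped MatrixOrder Matrix.Norms.L2Operator in
theorem PosSemidef.exists_eq_conjTranspose_mul_self {X : Matrix n n ℂ} (hX : X.PosSemidef) :
    ∃ D : Matrix n n ℂ, X = Dᴴ * D :=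
  CStarAlgebra.nonneg_iff_eq_star_mul_self.1 hX.nonneg

theorem PosDef.exists_isUnit_eq_conjTranspose_mul_self {X : Matrix n n ℂ} (hX : X.PosDef) :
    ∃ D : Matrix n n ℂ, IsUnit D ∧ X = Dᴴ * D := by
  obtain ⟨D, hD⟩ := hX.posSemidef.exists_eq_conjTranspose_mul_self
  refine ⟨D, ?_, hD⟩
  have h : IsUnit (Dᴴ * D) := by
    rw [← hD]
    exact hX.isUnit
  rw [isUnit_iff_isUnit_det, det_mul] at h
  exact (isUnit_iff_isUnit_det D).2 (isUnit_of_mul_isUnit_right h)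

theorem PosDef.card_add_log_det_add_log_det_le_trace_mul {X Y : Matrix n n ℂ}
    (hX : X.PosDef) (hY : Y.PosDef) :
    (Fintype.card n : ℝ) + Real.log X.det.re + Real.log Y.det.re ≤ (X * Y).trace.re := by
  obtain ⟨D, hD, rfl⟩ := hY.exists_isUnit_eq_conjTranspose_mul_self
  have hDX : (D * X * Dᴴ).PosDef := by
    refine hX.mul_mul_conjTranspose_same ?_
    exact vecMul_injective_of_isUnit hD
  have hdet : (D * X * Dᴴ).det.re = X.det.re * (Dᴴ * D).det.re := by
    rw [← hX.det_re_mul]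
    congr 1
    simp only [det_mul]
    ring
  have htr : (X * (Dᴴ * D)).trace = (D * X * Dᴴ).trace := by
    rw [← Matrix.mul_assoc, trace_mul_comm, ← Matrix.mul_assoc]
  have h := hDX.card_add_log_det_le_trace
  rw [hdet, Real.log_mul hX.det_re_pos.ne' hY.det_re_pos.ne'] at h
  rw [htr]
  linarith

theorem PosSemidef.trace_mul_re_nonneg {X Y : Matrix n n ℂ}
    (hX : X.PosSemidef) (hY : Y.PosSemidef) : 0 ≤ (X * Y).trace.re := by
  obtain ⟨D, rfl⟩ := hY.exists_eq_conjTranspose_mul_self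
  rw [← Matrix.mul_assoc, trace_mul_comm, ← Matrix.mul_assoc]
  exact (Complex.nonneg_iff.1 (hX.mul_mul_conjTranspose_same D).trace_nonneg).1

/-- The mean-square-error matrix of a receiver `U` for effective channel `A` and noise
covariance `Q`. -/
def mseMatrix (A : Matrix m n ℂ) (Q : Matrix m m ℂ) (U : Matrix m n ℂ) : Matrix n n ℂ :=
  (1 - Uᴴ * A) * (1 - Uᴴ * A)ᴴ + Uᴴ * Q * U

/-- The inverse of the minimum mean-square-error matrix. -/
noncomputable def mmseWeight (A : Matrix m n ℂ) (Q : Matrix m m ℂ) : Matrix n n ℂ :=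
  1 + Aᴴ * Q⁻¹ * A

/-- The receiver minimizing the mean-square-error matrix. -/
noncomputable def mmseReceiver (A : Matrix m n ℂ) (Q : Matrix m m ℂ) : Matrix m n ℂ :=
  Q⁻¹ * A * (mmseWeight A Q)⁻¹

variable {A : Matrix m n ℂ} {Q : Matrix m m ℂ}

theorem posDef_mmseWeight (hQ : Q.PosDef) : (mmseWeight A Q).PosDef :=
  PosDef.one.add_posSemidef (hQ.inv.posSemidef.conjTranspose_mul_mul_same A)

theorem det_mmseWeight : (mmseWeight A Q).det = (1 + A * Aᴴ * Q⁻¹).det := by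
  rw [mmseWeight, Matrix.mul_assoc, det_one_add_mul_comm, Matrix.mul_assoc, det_one_add_mul_comm]

theorem mseMatrix_eq (hQ : Q.PosDef) (U : Matrix m n ℂ) :
    mseMatrix A Q U = (mmseWeight A Q)⁻¹ +
      (U - mmseReceiver A Q)ᴴ * (A * Aᴴ + Q) * (U - mmseReceiver A Q) := by
  have hW := posDef_mmseWeight (A := A) hQ
  have hWi : ((mmseWeight A Q)⁻¹)ᴴ = (mmseWeight A Q)⁻¹ := hW.inv.1
  have hQi : (Q⁻¹)ᴴ = Q⁻¹ := hQ.inv.1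
  have hQQ : Q * Q⁻¹ = 1 := mul_nonsing_inv _ ((isUnit_iff_isUnit_det _).1 hQ.isUnit)
  have hWW : (mmseWeight A Q)⁻¹ * mmseWeight A Q = 1 :=
    nonsing_inv_mul _ ((isUnit_iff_isUnit_det _).1 hW.isUnit)
  have hQR : Q * mmseReceiver A Q = A * (mmseWeight A Q)⁻¹ := by
    rw [mmseReceiver, ← Matrix.mul_assoc, ← Matrix.mul_assoc, hQQ, Matrix.one_mul]
  have hRQ : (mmseReceiver A Q)ᴴ * Q = (mmseWeight A Q)⁻¹ * Aᴴ := by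
    have h := congrArg conjTranspose hQR
    rwa [conjTranspose_mul, conjTranspose_mul, hWi, hQ.1.eq] at h
  have hRA : (mmseReceiver A Q)ᴴ * A = 1 - (mmseWeight A Q)⁻¹ := by
    have h : Aᴴ * Q⁻¹ * A = mmseWeight A Q - 1 := by simp [mmseWeight]
    rw [mmseReceiver, conjTranspose_mul, conjTranspose_mul, hWi, hQi, Matrix.mul_assoc, h,
      Matrix.mul_sub, hWW, Matrix.mul_one]
  have hAR : Aᴴ * mmseReceiver A Q = 1 - (mmseWeight A Q)⁻¹ := by
    have h := congrArg conjTranspose hRA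
    rwa [conjTranspose_mul, conjTranspose_sub, conjTranspose_one, hWi,
      conjTranspose_conjTranspose] at h
  generalize mmseReceiver A Q = R at *
  generalize (mmseWeight A Q)⁻¹ = S at *
  obtain ⟨D, rfl⟩ : ∃ D, U = R + D := ⟨U - R, by simp⟩
  have h1 : 1 - (R + D)ᴴ * A = S - Dᴴ * A := by
    rw [conjTranspose_add, Matrix.add_mul, hRA]
    abel
  have h2 : (S - Dᴴ * A)ᴴ = S - Aᴴ * D := by
    rw [conjTranspose_sub, hWi, conjTranspose_mul, conjTranspose_conjTranspose]
  have h3 : (R + D)ᴴ * Q * (R + D) = S * (1 - S) + S * (Aᴴ * D) + Dᴴ * A * S + Dᴴ * Q * D := by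
    rw [conjTranspose_add, Matrix.add_mul, hRQ, Matrix.add_mul, Matrix.mul_add, Matrix.mul_add,
      Matrix.mul_assoc S, hAR, Matrix.mul_assoc S, Matrix.mul_assoc Dᴴ Q R, hQR,
      ← Matrix.mul_assoc Dᴴ A S]
    abel
  rw [mseMatrix, h1, h2, h3, add_sub_cancel_left]
  simp only [Matrix.mul_add, Matrix.add_mul, Matrix.mul_sub, Matrix.sub_mul, Matrix.mul_assoc,
    Matrix.mul_one]
  abel

theorem mseMatrix_mmseReceiver (hQ : Q.PosDef) :
    mseMatrix A Q (mmseReceiver A Q) = (mmseWeight A Q)⁻¹ := by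
  simp [mseMatrix_eq hQ]

theorem card_sub_log_det_le_weighted_mse (hQ : Q.PosDef) {W : Matrix n n ℂ} (hW : W.PosDef)
    (U : Matrix m n ℂ) :
    (Fintype.card n : ℝ) - Real.log (1 + A * Aᴴ * Q⁻¹).det.re ≤
      (W * mseMatrix A Q U).trace.re - Real.log W.det.re := by
  have hS := posDef_mmseWeight (A := A) hQ
  have hdet : Real.log (mmseWeight A Q)⁻¹.det.re = -Real.log (mmseWeight A Q).det.re := by
    have h := hS.det_re_mul (Y := (mmseWeight A Q)⁻¹)
    rw [← det_mul, mul_nonsing_inv _ ((isUnit_iff_isUnit_det _).1 hS.isUnit), det_one,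
      Complex.one_re] at h
    rw [eq_inv_of_mul_eq_one_right h.symm, Real.log_inv]
  have hle := hW.card_add_log_det_add_log_det_le_trace_mul hS.inv
  have hJ : (A * Aᴴ + Q).PosSemidef := (posSemidef_self_mul_conjTranspose A).add hQ.posSemidef
  have hnn := hW.posSemidef.trace_mul_re_nonneg
    (hJ.conjTranspose_mul_mul_same (U - mmseReceiver A Q))
  rw [mseMatrix_eq hQ, Matrix.mul_add, trace_add, Complex.add_re, ← det_mmseWeight]
  linarith

theorem weighted_mse_mmse (hQ : Q.PosDef) :
    (mmseWeight A Q * mseMatrix A Q (mmseReceiver A Q)).trace.re -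
      Real.log (mmseWeight A Q).det.re =
    (Fintype.card n : ℝ) - Real.log (1 + A * Aᴴ * Q⁻¹).det.re := by
  have hS := posDef_mmseWeight (A := A) hQ
  rw [mseMatrix_mmseReceiver hQ, mul_nonsing_inv _ ((isUnit_iff_isUnit_det _).1 hS.isUnit),
    det_mmseWeight, trace_one, Complex.natCast_re]

end Matrix

/-- Equivalence of the power-minimization problems under weighted-MSE constraints and under
rate constraints: if `(W*, U*, V*)` is MSE-feasible and minimizes the sum power among all
MSE-feasible triples, then `V*` is rate-feasible and minimizes the sum power among all
rate-feasible precoder families. -/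
theorem stmt_0 (M K NT NR : ℕ) (hM : 0 < M) (hK : 0 < K) (hNT : 0 < NT) (hNR : 0 < NR)
    (H : Fin M → Fin K → Fin K → Matrix (Fin NR) (Fin NT) ℂ)
    (μbar : Fin K → ℝ)
    -- interference-plus-noise covariance
    (Ω : (Fin M → Fin K → Matrix (Fin NT) (Fin (min NT NR)) ℂ) →
      Fin M → Fin K → Matrix (Fin NR) (Fin NR) ℂ)
    (hΩ : ∀ V m k, Ω V m k =
      1 + ∑ n ∈ Finset.univ.erase k, H m k n * V m n * (V m n)ᴴ * (H m k n)ᴴ)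
    -- user rate
    (Rbar : (Fin M → Fin K → Matrix (Fin NT) (Fin (min NT NR)) ℂ) → Fin K → ℝ)
    (hR : ∀ V k, Rbar V k = ((M : ℝ))⁻¹ * ∑ m, Real.log
      (((1 : Matrix (Fin NR) (Fin NR) ℂ)
        + H m k k * V m k * (V m k)ᴴ * (H m k k)ᴴ * (Ω V m k)⁻¹).det.re))
    -- sum transmit power
    (P : (Fin M → Fin K → Matrix (Fin NT) (Fin (min NT NR)) ℂ) → ℝ)
    (hP : ∀ V, P V = ∑ k, ∑ m, (Matrix.trace (V m k * (V m k)ᴴ)).re)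
    -- MSE matrix
    (E : (Fin M → Fin K → Matrix (Fin NR) (Fin (min NT NR)) ℂ) →
      (Fin M → Fin K → Matrix (Fin NT) (Fin (min NT NR)) ℂ) →
      Fin M → Fin K → Matrix (Fin (min NT NR)) (Fin (min NT NR)) ℂ)
    (hE : ∀ U V m k, E U V m k =
      (1 - (U m k)ᴴ * H m k k * V m k) * (1 - (U m k)ᴴ * H m k k * V m k)ᴴ +
      (U m k)ᴴ * Ω V m k * U m k)
    -- feasibility notions
    (MSEFeasible : (Fin M → Fin K → Matrix (Fin (min NT NR)) (Fin (min NT NR)) ℂ) →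
      (Fin M → Fin K → Matrix (Fin NR) (Fin (min NT NR)) ℂ) →
      (Fin M → Fin K → Matrix (Fin NT) (Fin (min NT NR)) ℂ) → Prop)
    (hMSEFeasible : ∀ W U V, MSEFeasible W U V ↔
      (∀ m k, (W m k).PosDef) ∧
      ∀ k, ((M : ℝ))⁻¹ * ∑ m, ((Matrix.trace (W m k * E U V m k)).re
        - Real.log ((W m k).det.re)) ≤ (min NT NR : ℝ) - μbar k)
    (RateFeasible : (Fin M → Fin K → Matrix (Fin NT) (Fin (min NT NR)) ℂ) → Prop)
    (hRateFeasible : ∀ V, RateFeasible V ↔ ∀ k, Rbar V k ≥ μbar k)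
    -- the optimal MSE-feasible triple
    (Wstar : Fin M → Fin K → Matrix (Fin (min NT NR)) (Fin (min NT NR)) ℂ)
    (Ustar : Fin M → Fin K → Matrix (Fin NR) (Fin (min NT NR)) ℂ)
    (Vstar : Fin M → Fin K → Matrix (Fin NT) (Fin (min NT NR)) ℂ)
    (hfeas : MSEFeasible Wstar Ustar Vstar)
    (hopt : ∀ W U V, MSEFeasible W U V → P Vstar ≤ P V) :
    RateFeasible Vstar ∧ ∀ V, RateFeasible V → P Vstar ≤ P V := by
  have hQ : ∀ V m k, (Ω V m k).PosDef := fun V m k => by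
    rw [hΩ]
    refine PosDef.one.add_posSemidef (posSemidef_sum _ fun n _ => ?_)
    rw [Matrix.mul_assoc _ _ (H m k n)ᴴ, ← conjTranspose_mul]
    exact posSemidef_self_mul_conjTranspose _
  have hEmse : ∀ U V m k, E U V m k = mseMatrix (H m k k * V m k) (Ω V m k) (U m k) :=
    fun U V m k => by rw [hE, mseMatrix, Matrix.mul_assoc _ (H m k k)]
  have hgram : ∀ (V : Fin M → Fin K → Matrix (Fin NT) (Fin (min NT NR)) ℂ) m k,
      H m k k * V m k * (V m k)ᴴ * (H m k k)ᴴ = (H m k k * V m k) * (H m k k * V m k)ᴴ :=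
    fun V m k => by rw [conjTranspose_mul, ← Matrix.mul_assoc]
  have hM' : (M : ℝ) ≠ 0 := by exact_mod_cast hM.ne'
  have havg : ∀ V k, ((M : ℝ))⁻¹ * ∑ m, ((Fintype.card (Fin (min NT NR)) : ℝ) -
      Real.log (1 + (H m k k * V m k) * (H m k k * V m k)ᴴ * (Ω V m k)⁻¹).det.re) =
      (min NT NR : ℝ) - Rbar V k := fun V k => by
    rw [hR, Finset.sum_sub_distrib, mul_sub]
    simp only [hgram, Finset.sum_const, Finset.card_univ, Fintype.card_fin, nsmul_eq_mul,
      Nat.cast_min]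
    rw [inv_mul_cancel_left₀ hM']
  refine ⟨(hRateFeasible _).2 fun k => ?_, fun V hV => ?_⟩
  · obtain ⟨hW, hk⟩ := (hMSEFeasible _ _ _).1 hfeas
    have hle := mul_le_mul_of_nonneg_left
      (Finset.sum_le_sum fun m (_ : m ∈ Finset.univ) => card_sub_log_det_le_weighted_mse
        (A := H m k k * Vstar m k) (hQ Vstar m k) (hW m k) (Ustar m k))
      (inv_nonneg.2 (Nat.cast_nonneg (α := ℝ) M))
    rw [havg] at hle
    have hk' := hk k
    simp only [hEmse] at hk'
    linarith
  · refine hopt (fun m k => mmseWeight (H m k k * V m k) (Ω V m k))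
      (fun m k => mmseReceiver (H m k k * V m k) (Ω V m k)) V ((hMSEFeasible _ _ _).2
      ⟨fun m k => posDef_mmseWeight (hQ V m k), fun k => ?_⟩)
    simp only [hEmse, weighted_mse_mmse (hQ V _ k)]
    rw [havg]
    linarith [(hRateFeasible V).1 hV k]
end

section
/- Let E ∈ ℂ^{d×d} be Hermitian positive definite. Then for every Hermitian positive definite W ∈ ℂ^{d×d}, Re Tr(W E) − log det W ≥ d + log det E, and equality holds when W = E^{-1}. -/
open Matrix ComplexOrder

/-- For positive definite `A`, the inequality `log x ≤ x - 1` applied to the eigenvalues. -/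
theorem Matrix.PosDef.card_add_log_det_le_trace_s1 {n : Type*} [Fintype n] [DecidableEq n]
    {A : Matrix n n ℂ} (hA : A.PosDef) :
    (Fintype.card n : ℝ) + Real.log A.det.re ≤ A.trace.re := by
  have hdet : A.det.re = ∏ i, hA.isHermitian.eigenvalues i := by
    rw [hA.isHermitian.det_eq_prod_eigenvalues]
    exact_mod_cast Complex.ofReal_re _
  have htr : A.trace.re = ∑ i, hA.isHermitian.eigenvalues i := by
    rw [hA.isHermitian.trace_eq_sum_eigenvalues]
    exact_mod_cast Complex.ofReal_re _
  rw [hdet, htr, Real.log_prod fun i _ ↦ (hA.eigenvalues_pos i).ne']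
  have h := Finset.sum_le_sum fun i (_ : i ∈ Finset.univ) ↦
    Real.log_le_sub_one_of_pos (hA.eigenvalues_pos i)
  simp only [Finset.sum_sub_distrib, Finset.sum_const, Finset.card_univ, nsmul_eq_mul,
    mul_one] at h
  linarith

open scoped MatrixOrder in
/-- A product of two positive definite matrices has the trace and determinant of a positive
definite matrix, to which it is similar. -/
theorem Matrix.PosDef.exists_posDef_trace_eq_det_eq {n : Type*} [Fintype n] [DecidableEq n]
    {W E : Matrix n n ℂ} (hW : W.PosDef) (hE : E.PosDef) :
    ∃ A : Matrix n n ℂ, A.PosDef ∧ A.trace = (W * E).trace ∧ A.det = (W * E).det := by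
  obtain ⟨B, hB, rfl⟩ := CStarAlgebra.isStrictlyPositive_iff_eq_star_mul_self.mp
    hE.isStrictlyPositive
  refine ⟨B * W * star B, (Matrix.IsUnit.posDef_star_right_conjugate_iff hB).mpr hW, ?_, ?_⟩
  · rw [mul_assoc, trace_mul_comm, mul_assoc]
  · simp only [det_mul]
    ring

theorem Matrix.PosDef.log_det_mul {n : Type*} [Fintype n] [DecidableEq n]
    {W E : Matrix n n ℂ} (hW : W.PosDef) (hE : E.PosDef) :
    Real.log (W * E).det.re = Real.log W.det.re + Real.log E.det.re := by
  obtain ⟨hWre, hWim⟩ := Complex.pos_iff.mp hW.det_pos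
  obtain ⟨hEre, -⟩ := Complex.pos_iff.mp hE.det_pos
  rw [det_mul, Complex.mul_re, ← hWim, zero_mul, sub_zero, Real.log_mul hWre.ne' hEre.ne']

/-- For a Hermitian positive definite `E`, the function
`W ↦ Re Tr(W E) − log det W` over Hermitian positive definite `W` is bounded below by
`d + log det E`, with equality at `W = E⁻¹`. -/
theorem stmt_1 (d : ℕ) (E : Matrix (Fin d) (Fin d) ℂ) (hE : E.PosDef) :
    (∀ W : Matrix (Fin d) (Fin d) ℂ, W.PosDef →
      (Matrix.trace (W * E)).re - Real.log W.det.re ≥ (d : ℝ) + Real.log E.det.re) ∧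
    (Matrix.trace (E⁻¹ * E)).re - Real.log (E⁻¹).det.re = (d : ℝ) + Real.log E.det.re := by
  constructor
  · intro W hW
    obtain ⟨A, hA, htr, hdet⟩ := hW.exists_posDef_trace_eq_det_eq hE
    have h := hA.card_add_log_det_le_trace_s1
    rw [htr, hdet, hW.log_det_mul hE, Fintype.card_fin] at h
    linarith
  · have hinv : E⁻¹ * E = 1 := nonsing_inv_mul E ((isUnit_iff_isUnit_det E).mp hE.isUnit)
    have h := hE.inv.log_det_mul hE
    rw [hinv, det_one, Complex.one_re, Real.log_one] at h
    rw [hinv, trace_one, Fintype.card_fin, Complex.natCast_re]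
    linarith
end

section
/- Let Ω ∈ ℂ^{N_R×N_R} be Hermitian positive definite, H ∈ ℂ^{N_R×N_T}, V ∈ ℂ^{N_T×d}. Then for every receiver U ∈ ℂ^{N_R×d} and every Hermitian positive definite weight W ∈ ℂ^{d×d}, Re Tr(W E(U)) − log det W ≥ d − log det(I + H V Vᴴ Hᴴ Ω^{-1}), where E(U) = (I − Uᴴ H V)(I − Uᴴ H V)ᴴ + Uᴴ Ω U. -/
open Matrix ComplexOrder

open scoped MatrixOrder in
theorem Matrix.PosSemidef.exists_eq_conjTranspose_mul_self_s5 {n : Type*} [Fintype n] [DecidableEq n]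
    {A : Matrix n n ℂ} (hA : A.PosSemidef) : ∃ B : Matrix n n ℂ, A = Bᴴ * B :=
  CStarAlgebra.nonneg_iff_eq_star_mul_self.mp hA.nonneg

theorem Matrix.PosSemidef.trace_mul_nonneg {n : Type*} [Fintype n]
    {A B : Matrix n n ℂ} (hA : A.PosSemidef) (hB : B.PosSemidef) : 0 ≤ (A * B).trace := by
  classical
  obtain ⟨C, rfl⟩ := hA.exists_eq_conjTranspose_mul_self_s5
  rw [Matrix.mul_assoc, Matrix.trace_mul_comm]
  exact (hB.mul_mul_conjTranspose_same C).trace_nonneg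

theorem Matrix.PosDef.card_le_re_trace_sub_log_det {n : Type*} [Fintype n] [DecidableEq n]
    {A : Matrix n n ℂ} (hA : A.PosDef) :
    (Fintype.card n : ℝ) ≤ A.trace.re - Real.log A.det.re := by
  rw [hA.isHermitian.trace_eq_sum_eigenvalues, hA.isHermitian.det_eq_prod_eigenvalues]
  simp only [Complex.coe_algebraMap, ← Complex.ofReal_sum, ← Complex.ofReal_prod,
    Complex.ofReal_re]
  rw [Real.log_prod fun i _ => (hA.eigenvalues_pos i).ne', ← Finset.sum_sub_distrib]
  calc (Fintype.card n : ℝ) = ∑ _i : n, (1 : ℝ) := by simp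
    _ ≤ _ := Finset.sum_le_sum fun i _ => by
      linarith [Real.log_le_sub_one_of_pos (hA.eigenvalues_pos i)]

theorem Matrix.PosDef.card_le_re_trace_mul_sub_log_det_mul {n : Type*} [Fintype n] [DecidableEq n]
    {A B : Matrix n n ℂ} (hA : A.PosDef) (hB : B.PosDef) :
    (Fintype.card n : ℝ) ≤ (A * B).trace.re - Real.log (A * B).det.re := by
  obtain ⟨C, rfl⟩ := hA.posSemidef.exists_eq_conjTranspose_mul_self_s5
  have hdet : (C * B * Cᴴ).det = (Cᴴ * C * B).det := by
    simp only [Matrix.det_mul]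
    ring
  have hC : (C * B * Cᴴ).PosDef := by
    rw [(hB.posSemidef.mul_mul_conjTranspose_same C).posDef_iff_det_ne_zero, hdet,
      Matrix.det_mul]
    exact mul_ne_zero hA.det_pos.ne' hB.det_pos.ne'
  rw [← hdet, Matrix.mul_assoc Cᴴ C B, Matrix.trace_mul_comm]
  exact hC.card_le_re_trace_sub_log_det

/-- The mean square error of a linear receiver `U` for the channel `G` with noise covariance `Ω`
is the minimal one plus a quadratic form in the deviation from the optimal receiver. -/
theorem Matrix.PosDef.mse_eq_inv_add {m n : Type*} [Fintype m] [Fintype n] [DecidableEq m]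
    [DecidableEq n] {Ω : Matrix m m ℂ} (hΩ : Ω.PosDef) (G U : Matrix m n ℂ)
    {F : Matrix n n ℂ} (hF : F.PosDef) (hFG : F = 1 + Gᴴ * Ω⁻¹ * G) :
    (1 - Uᴴ * G) * (1 - Uᴴ * G)ᴴ + Uᴴ * Ω * U =
      F⁻¹ + (U - Ω⁻¹ * G * F⁻¹)ᴴ * (Ω + G * Gᴴ) * (U - Ω⁻¹ * G * F⁻¹) := by
  have hFu : F * F⁻¹ = 1 := Matrix.mul_nonsing_inv F ((Matrix.isUnit_iff_isUnit_det F).1 hF.isUnit)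
  have hΩu : Ω * Ω⁻¹ = 1 :=
    Matrix.mul_nonsing_inv Ω ((Matrix.isUnit_iff_isUnit_det Ω).1 hΩ.isUnit)
  set M := Ω⁻¹ * G * F⁻¹ with hM
  have hRM : (Ω + G * Gᴴ) * M = G := by
    calc (Ω + G * Gᴴ) * M = (Ω * Ω⁻¹ * G + G * (Gᴴ * Ω⁻¹ * G)) * F⁻¹ := by
          simp only [hM, Matrix.add_mul, Matrix.mul_assoc]
      _ = G * F * F⁻¹ := by rw [hΩu, hFG, Matrix.one_mul, Matrix.mul_add, Matrix.mul_one]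
      _ = G := by rw [Matrix.mul_assoc, hFu, Matrix.mul_one]
  have hMR : Mᴴ * (Ω + G * Gᴴ) = Gᴴ := by
    have hR : (Ω + G * Gᴴ).IsHermitian :=
      hΩ.isHermitian.add (Matrix.isHermitian_mul_conjTranspose_self G)
    calc Mᴴ * (Ω + G * Gᴴ) = ((Ω + G * Gᴴ) * M)ᴴ := by
          rw [Matrix.conjTranspose_mul _ M, hR.eq]
      _ = Gᴴ := by rw [hRM]
  have hGM : Gᴴ * M = 1 - F⁻¹ := by
    calc Gᴴ * M = (F - 1) * F⁻¹ := by
          rw [hFG, add_sub_cancel_left, ← hFG, hM]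
          simp only [Matrix.mul_assoc]
      _ = 1 - F⁻¹ := by rw [Matrix.sub_mul, hFu, Matrix.one_mul]
  have hexp : (U - M)ᴴ * (Ω + G * Gᴴ) * (U - M) =
      Uᴴ * (Ω + G * Gᴴ) * U - Uᴴ * G - Gᴴ * U + (1 - F⁻¹) := by
    rw [Matrix.conjTranspose_sub, Matrix.sub_mul, hMR, Matrix.sub_mul, Matrix.mul_sub,
      Matrix.mul_sub, hGM, Matrix.mul_assoc Uᴴ _ M, hRM]
    abel
  rw [hexp]
  simp only [Matrix.conjTranspose_sub, Matrix.conjTranspose_one, Matrix.conjTranspose_mul,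
    Matrix.conjTranspose_conjTranspose, Matrix.sub_mul, Matrix.mul_sub, Matrix.add_mul,
    Matrix.mul_add, Matrix.one_mul, Matrix.mul_one, Matrix.mul_assoc]
  abel

/-- For every receiver `U` and Hermitian positive definite weight `W`,
`Re Tr(W E(U)) − log det W ≥ d − log det(I + H V Vᴴ Hᴴ Ω⁻¹)`. -/
theorem stmt_5 (NR NT d : ℕ)
    (Ω : Matrix (Fin NR) (Fin NR) ℂ) (hΩ : Ω.PosDef)
    (H : Matrix (Fin NR) (Fin NT) ℂ) (V : Matrix (Fin NT) (Fin d) ℂ)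
    (E : Matrix (Fin NR) (Fin d) ℂ → Matrix (Fin d) (Fin d) ℂ)
    (hEdef : ∀ U, E U = (1 - Uᴴ * H * V) * (1 - Uᴴ * H * V)ᴴ + Uᴴ * Ω * U) :
    ∀ (U : Matrix (Fin NR) (Fin d) ℂ) (W : Matrix (Fin d) (Fin d) ℂ), W.PosDef →
      (Matrix.trace (W * E U)).re - Real.log W.det.re ≥
        (d : ℝ) - Real.log ((1 + H * V * Vᴴ * Hᴴ * Ω⁻¹).det.re) := by
  intro U W hW
  obtain ⟨G, hG⟩ : ∃ G, G = H * V := ⟨_, rfl⟩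
  obtain ⟨F, hFG⟩ : ∃ F, F = 1 + Gᴴ * Ω⁻¹ * G := ⟨_, rfl⟩
  have hF : F.PosDef := hFG ▸
    Matrix.PosDef.one.add_posSemidef (hΩ.inv.posSemidef.conjTranspose_mul_mul_same G)
  have hdet : (1 + H * V * Vᴴ * Hᴴ * Ω⁻¹).det = F.det := by
    have hGG : H * V * Vᴴ * Hᴴ * Ω⁻¹ = G * (Gᴴ * Ω⁻¹) := by
      simp only [hG, Matrix.conjTranspose_mul, Matrix.mul_assoc]
    rw [hGG, Matrix.det_one_add_mul_comm, hFG]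
  have hE : E U = F⁻¹ + (U - Ω⁻¹ * G * F⁻¹)ᴴ * (Ω + G * Gᴴ) * (U - Ω⁻¹ * G * F⁻¹) := by
    rw [hEdef, Matrix.mul_assoc Uᴴ H V, ← hG, hΩ.mse_eq_inv_add G U hF hFG]
  have hR : (Ω + G * Gᴴ).PosSemidef :=
    hΩ.posSemidef.add (Matrix.posSemidef_self_mul_conjTranspose G)
  have hexcess := (Complex.le_def.1 (hW.posSemidef.trace_mul_nonneg
    (hR.conjTranspose_mul_mul_same (U - Ω⁻¹ * G * F⁻¹)))).1
  have hmin := hW.card_le_re_trace_mul_sub_log_det_mul hF.inv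
  have hWpos := Complex.lt_def.1 hW.det_pos
  have hFpos := Complex.lt_def.1 hF.inv.det_pos
  have hlog : Real.log (W * F⁻¹).det.re = Real.log W.det.re - Real.log F.det.re := by
    have hinv : F⁻¹.det.re = F.det.re⁻¹ := by
      have hFre : F.det = (F.det.re : ℂ) :=
        Complex.ext rfl (Complex.lt_def.1 hF.det_pos).2.symm
      rw [Matrix.det_nonsing_inv, Ring.inverse_eq_inv', hFre, ← Complex.ofReal_inv,
        Complex.ofReal_re, Complex.ofReal_re]
    rw [Matrix.det_mul, Complex.mul_re, ← hWpos.2, Complex.zero_im, zero_mul, sub_zero,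
      Real.log_mul hWpos.1.ne' hFpos.1.ne', hinv, Real.log_inv, sub_eq_add_neg]
  rw [hlog, Fintype.card_fin] at hmin
  rw [hdet, hE, Matrix.mul_add, Matrix.trace_add, Complex.add_re]
  rw [Complex.zero_re] at hexcess
  linarith
end

section
/- For each k, let V*_k = (I + Σ_{n=1}^K λ_n H_{n,k}ᴴ U_n W_n U_nᴴ H_{n,k})^{-1} (λ_k H_{k,k}ᴴ U_k W_k); the inverted matrix is I plus a positive semidefinite matrix and hence invertible. Then f(V*_1, ..., V*_K) ≤ f(V_1, ..., V_K) for all V_1, ..., V_K ∈ ℂ^{N_T×d}. -/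
open Matrix ComplexOrder

/-- A matrix `X` with `M * X = B`, `M` positive semidefinite, minimizes the quadratic function
`V ↦ Re Tr(Vᴴ M V) - 2 Re Tr(Bᴴ V)`. -/
theorem Matrix.PosSemidef.quadratic_trace_le {m n : Type*} [Fintype m] [Fintype n]
    {M : Matrix m m ℂ} (hM : M.PosSemidef) {B X : Matrix m n ℂ} (hX : M * X = B)
    (V : Matrix m n ℂ) :
    (trace (Xᴴ * M * X)).re - 2 * (trace (Bᴴ * X)).re ≤
      (trace (Vᴴ * M * V)).re - 2 * (trace (Bᴴ * V)).re := by
  have hXM : Bᴴ = Xᴴ * M := by rw [← hX, conjTranspose_mul, hM.1.eq]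
  have hnonneg : 0 ≤ (trace ((V - X)ᴴ * M * (V - X))).re :=
    (Complex.le_def.1 (hM.conjTranspose_mul_mul_same (V - X)).trace_nonneg).1
  have hcross : (trace (Vᴴ * M * X)).re = (trace (Xᴴ * M * V)).re := by
    have h : (Vᴴ * M * X) = (Xᴴ * M * V)ᴴ := by
      simp [conjTranspose_mul, hM.1.eq, Matrix.mul_assoc]
    rw [h, trace_conjTranspose]
    simp
  rw [hXM]
  simp only [conjTranspose_sub, Matrix.sub_mul, Matrix.mul_sub, trace_sub, Complex.sub_re]
    at hnonneg
  linarith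

/-- The weighted trace of the mean square error splits into a constant, a term linear in the own
precoder, and a sum of quadratic terms, one for each precoder. -/
theorem trace_weighted_mse_re {ι m n d : Type*} [Fintype ι] [DecidableEq ι] [Fintype m]
    [DecidableEq m] [Fintype n] [Fintype d] [DecidableEq d] (i : ι)
    (H : ι → Matrix m n ℂ) (U : Matrix m d ℂ) {W : Matrix d d ℂ} (hW : W.IsHermitian)
    (V : ι → Matrix n d ℂ) :
    (trace (W * ((1 - Uᴴ * H i * V i) * (1 - Uᴴ * H i * V i)ᴴ +
      Uᴴ * (1 + ∑ k ∈ Finset.univ.erase i, H k * V k * (V k)ᴴ * (H k)ᴴ) * U))).re =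
    (trace (W * (1 + Uᴴ * U))).re - 2 * (trace (((H i)ᴴ * U * W)ᴴ * V i)).re +
      ∑ k, (trace ((V k)ᴴ * ((H k)ᴴ * U * W * Uᴴ * H k) * V k)).re := by
  have hquad : ∀ k, trace ((V k)ᴴ * ((H k)ᴴ * U * W * Uᴴ * H k) * V k) =
      trace (W * (Uᴴ * (H k * V k * (V k)ᴴ * (H k)ᴴ) * U)) := fun k => by
    have h := trace_mul_comm ((V k)ᴴ * (H k)ᴴ * U) (W * Uᴴ * H k * V k)
    simpa only [Matrix.mul_assoc] using h
  have hlin : (trace (W * (Uᴴ * H i * V i)ᴴ)).re = (trace (W * (Uᴴ * H i * V i))).re := by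
    have h : W * (Uᴴ * H i * V i)ᴴ = ((Uᴴ * H i * V i) * W)ᴴ := by
      rw [conjTranspose_mul _ W, hW.eq]
    rw [h, trace_conjTranspose, trace_mul_comm]
    simp
  have hadj : ((H i)ᴴ * U * W)ᴴ * V i = W * (Uᴴ * H i * V i) := by
    simp [conjTranspose_mul, hW.eq, Matrix.mul_assoc]
  have hexp : (1 - Uᴴ * H i * V i) * (1 - Uᴴ * H i * V i)ᴴ +
      Uᴴ * (1 + ∑ k ∈ Finset.univ.erase i, H k * V k * (V k)ᴴ * (H k)ᴴ) * U =
      (1 + Uᴴ * U) - Uᴴ * H i * V i - (Uᴴ * H i * V i)ᴴ +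
        ∑ k, Uᴴ * (H k * V k * (V k)ᴴ * (H k)ᴴ) * U := by
    have hii : (Uᴴ * H i * V i) * (Uᴴ * H i * V i)ᴴ =
        Uᴴ * (H i * V i * (V i)ᴴ * (H i)ᴴ) * U := by
      simp [conjTranspose_mul, Matrix.mul_assoc]
    rw [← Finset.add_sum_erase _ _ (Finset.mem_univ i), ← hii, conjTranspose_sub,
      conjTranspose_one, Matrix.mul_add, Matrix.add_mul, Matrix.mul_sum, Matrix.sum_mul]
    simp only [Matrix.sub_mul, Matrix.mul_sub, Matrix.one_mul, Matrix.mul_one]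
    abel
  simp only [hexp, hquad, hadj]
  rw [Matrix.mul_add W (_ - _), Matrix.mul_sub, Matrix.mul_sub, trace_add, trace_sub, trace_sub,
    Matrix.mul_sum, trace_sum]
  simp only [Complex.add_re, Complex.sub_re, Complex.re_sum, hlin]
  ring

/-- The closed-form precoders
`V*_k = (I + Σ_n λ_n H_{n,k}ᴴ U_n W_n U_nᴴ H_{n,k})⁻¹ (λ_k H_{k,k}ᴴ U_k W_k)`
globally minimize the Lagrangian
`f(V) = Σ_k Re Tr(V_k V_kᴴ) + Σ_n λ_n Re Tr(W_n E_n(V))`. -/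
theorem stmt_6 (K NT NR d : ℕ) (hK : 0 < K) (hNT : 0 < NT) (hNR : 0 < NR) (hd : 0 < d)
    (H : Fin K → Fin K → Matrix (Fin NR) (Fin NT) ℂ)
    (U : Fin K → Matrix (Fin NR) (Fin d) ℂ)
    (W : Fin K → Matrix (Fin d) (Fin d) ℂ) (hW : ∀ n, (W n).PosSemidef)
    (lam : Fin K → ℝ) (hlam : ∀ n, 0 ≤ lam n)
    (E : (Fin K → Matrix (Fin NT) (Fin d) ℂ) → Fin K → Matrix (Fin d) (Fin d) ℂ)
    (hE : ∀ V n, E V n =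
      (1 - (U n)ᴴ * H n n * V n) * (1 - (U n)ᴴ * H n n * V n)ᴴ +
      (U n)ᴴ * (1 + ∑ k ∈ Finset.univ.erase n, H n k * V k * (V k)ᴴ * (H n k)ᴴ) * U n)
    (f : (Fin K → Matrix (Fin NT) (Fin d) ℂ) → ℝ)
    (hf : ∀ V, f V = ∑ k, (Matrix.trace (V k * (V k)ᴴ)).re
      + ∑ n, lam n * (Matrix.trace (W n * E V n)).re)
    (Vstar : Fin K → Matrix (Fin NT) (Fin d) ℂ)
    (hVstar : ∀ k, Vstar k =
      (1 + ∑ n, (lam n : ℂ) • ((H n k)ᴴ * U n * W n * (U n)ᴴ * H n k))⁻¹ *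
        ((lam k : ℂ) • ((H k k)ᴴ * U k * W k))) :
    ∀ V : Fin K → Matrix (Fin NT) (Fin d) ℂ, f Vstar ≤ f V := by
  set M : Fin K → Matrix (Fin NT) (Fin NT) ℂ := fun k =>
    1 + ∑ n, (lam n : ℂ) • ((H n k)ᴴ * U n * W n * (U n)ᴴ * H n k) with hMdef
  set B : Fin K → Matrix (Fin NT) (Fin d) ℂ := fun k =>
    (lam k : ℂ) • ((H k k)ᴴ * U k * W k) with hBdef
  have hM : ∀ k, (M k).PosDef := fun k => by
    refine PosDef.one.add_posSemidef (posSemidef_sum _ fun n _ => ?_)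
    refine PosSemidef.smul ?_ (Complex.zero_le_real.2 (hlam n))
    have h := (hW n).conjTranspose_mul_mul_same ((U n)ᴴ * H n k)
    simpa [conjTranspose_mul, Matrix.mul_assoc] using h
  have hMV : ∀ k, M k * Vstar k = B k := fun k => by
    rw [hVstar k]
    exact mul_nonsing_inv_cancel_left _ _ ((isUnit_iff_isUnit_det _).1 (hM k).isUnit)
  have hMre : ∀ (V : Fin K → Matrix (Fin NT) (Fin d) ℂ) k,
      (trace ((V k)ᴴ * M k * V k)).re = (trace (V k * (V k)ᴴ)).re +
        ∑ n, lam n *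
          (trace ((V k)ᴴ * ((H n k)ᴴ * U n * W n * (U n)ᴴ * H n k) * V k)).re := fun V k => by
    simp only [hMdef, Matrix.mul_add, Matrix.add_mul, Matrix.mul_sum, Matrix.sum_mul,
      Matrix.mul_one, Matrix.mul_smul, Matrix.smul_mul, trace_add, trace_sum, trace_smul,
      Complex.add_re, Complex.re_sum, smul_eq_mul, Complex.re_ofReal_mul]
    rw [trace_mul_comm]
  have hBre : ∀ (V : Fin K → Matrix (Fin NT) (Fin d) ℂ) k,
      (trace ((B k)ᴴ * V k)).re =
        lam k * (trace (((H k k)ᴴ * U k * W k)ᴴ * V k)).re := fun V k => by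
    simp only [hBdef, conjTranspose_smul, Matrix.smul_mul, trace_smul, smul_eq_mul,
      Complex.star_def, Complex.conj_ofReal, Complex.re_ofReal_mul]
  have hfV : ∀ V, f V = ∑ k, ((trace ((V k)ᴴ * M k * V k)).re - 2 * (trace ((B k)ᴴ * V k)).re) +
      ∑ n, lam n * (trace (W n * (1 + (U n)ᴴ * U n))).re := fun V => by
    simp only [hf, hE, trace_weighted_mse_re _ (H _) _ (hW _).1]
    simp only [hMre, hBre, mul_add (lam _), mul_sub (lam _),
      Finset.sum_add_distrib, Finset.sum_sub_distrib, Finset.mul_sum]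
    rw [Finset.sum_comm]
    simp only [mul_left_comm (2 : ℝ)]
    ring
  intro V
  rw [hfV, hfV]
  refine add_le_add_left (Finset.sum_le_sum fun k _ => ?_) _
  exact (hM k).posSemidef.quadratic_trace_le (hMV k) (V k)
end

section
/- For every H ∈ ℂ^{N_R×N_T} and every V' ∈ ℂ^{N_T×d'} (with arbitrary d' ≥ 1), there exists V ∈ ℂ^{N_T×d} with d = min(N_T, N_R) such that H V Vᴴ Hᴴ = H V' V'ᴴ Hᴴ and Re Tr(V Vᴴ) ≤ Re Tr(V' V'ᴴ). -/
open Matrix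

open scoped ComplexOrder MatrixOrder

/-- A positive semidefinite complex matrix factors as `B * Bᴴ` with `B` square. -/
theorem Matrix.PosSemidef.exists_eq_mul_conjTranspose {n : Type*} [Fintype n] [DecidableEq n]
    {A : Matrix n n ℂ} (hA : A.PosSemidef) : ∃ B : Matrix n n ℂ, A = B * Bᴴ := by
  obtain ⟨B, hB⟩ := CStarAlgebra.nonneg_iff_eq_star_mul_self.mp hA.nonneg
  exact ⟨Bᴴ, by rw [conjTranspose_conjTranspose]; exact hB⟩

/-- For `r ≤ d` there is an `r × d` matrix with orthonormal rows. -/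
theorem Matrix.exists_mul_conjTranspose_eq_one {r d : ℕ} (h : r ≤ d) :
    ∃ E : Matrix (Fin r) (Fin d) ℂ, E * Eᴴ = 1 := by
  refine ⟨(1 : Matrix (Fin d) (Fin d) ℂ).submatrix (Fin.castLE h) id, ?_⟩
  rw [conjTranspose_submatrix, conjTranspose_one,
    ← submatrix_mul _ _ _ _ _ Function.bijective_id, Matrix.one_mul,
    submatrix_one _ (Fin.castLE_injective h)]

/-- The row space of `H` has an orthonormal basis of at most `min n m` vectors; as the columns of
a matrix `Q`, they satisfy `Qᴴ * Q = 1` and `H * (Q * Qᴴ) = H`. -/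
theorem Matrix.exists_orthonormal_rowSpace {m n : ℕ} (H : Matrix (Fin m) (Fin n) ℂ) :
    ∃ r ≤ min n m, ∃ Q : Matrix (Fin n) (Fin r) ℂ, Qᴴ * Q = 1 ∧ H * (Q * Qᴴ) = H := by
  let c : Fin m → EuclideanSpace ℂ (Fin n) := fun i => WithLp.toLp 2 fun j => star (H i j)
  let S : Submodule ℂ (EuclideanSpace ℂ (Fin n)) := Submodule.span ℂ (Set.range c)
  let b := stdOrthonormalBasis ℂ S
  refine ⟨Module.finrank ℂ S, le_min ?_ ?_, Matrix.of fun j k => (b k : EuclideanSpace ℂ (Fin n)) j,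
    ?_, ?_⟩
  · simpa using S.finrank_le
  · exact (finrank_range_le_card (R := ℂ) c).trans_eq (Fintype.card_fin m)
  · ext k l
    have h := orthonormal_iff_ite.mp b.orthonormal k l
    rw [Submodule.coe_inner, PiLp.inner_apply] at h
    simpa [mul_apply, one_apply, mul_comm] using h
  · rw [← Matrix.mul_assoc]
    ext i j
    have h := congrArg (fun x : S => star ((x : EuclideanSpace ℂ (Fin n)) j))
      (b.sum_repr' ⟨c i, Submodule.subset_span ⟨i, rfl⟩⟩)
    simpa [c, mul_apply, PiLp.inner_apply, mul_comm] using h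

/-- Compressing by the projection `Q * Qᴴ` does not increase the trace of `W * Wᴴ`. -/
theorem Matrix.re_trace_compression_le {n r k : Type*} [Fintype n] [Fintype r] [Fintype k]
    [DecidableEq n] [DecidableEq r] (Q : Matrix n r ℂ) (hQ : Qᴴ * Q = 1) (W : Matrix n k ℂ) :
    (trace (Q * (Qᴴ * W * Wᴴ * Q) * Qᴴ)).re ≤ (trace (W * Wᴴ)).re := by
  have hP : Q * Qᴴ * (Q * Qᴴ) = Q * Qᴴ := by
    rw [Matrix.mul_assoc, ← Matrix.mul_assoc Qᴴ, hQ, Matrix.one_mul]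
  have hsq : (1 - Q * Qᴴ)ᴴ * (1 - Q * Qᴴ) = 1 - Q * Qᴴ := by
    simp [Matrix.sub_mul, Matrix.mul_sub, hP]
  have htr : trace (Q * (Qᴴ * W * Wᴴ * Q) * Qᴴ) = trace (Q * Qᴴ * (W * Wᴴ)) := by
    calc trace (Q * (Qᴴ * W * Wᴴ * Q) * Qᴴ)
        = trace ((Q * Qᴴ * (W * Wᴴ)) * (Q * Qᴴ)) := by simp only [Matrix.mul_assoc]
      _ = trace (Q * Qᴴ * (W * Wᴴ)) := by rw [trace_mul_comm, ← Matrix.mul_assoc, hP]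
  have hpos : 0 ≤ trace (((1 - Q * Qᴴ) * W) * ((1 - Q * Qᴴ) * W)ᴴ) :=
    (posSemidef_self_mul_conjTranspose _).trace_nonneg
  have hdiff : trace (((1 - Q * Qᴴ) * W) * ((1 - Q * Qᴴ) * W)ᴴ)
      = trace (W * Wᴴ) - trace (Q * Qᴴ * (W * Wᴴ)) := by
    rw [trace_mul_comm, conjTranspose_mul, Matrix.mul_assoc, ← Matrix.mul_assoc _ _ W, hsq,
      trace_mul_comm, Matrix.mul_assoc, Matrix.sub_mul, Matrix.one_mul, trace_sub]
  rw [hdiff] at hpos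
  have := (Complex.le_def.mp hpos).1
  rw [htr]
  simpa using this

/-- Restricting to `d = min(N_T, N_R)` data streams loses nothing: for every precoder `V'`
with an arbitrary number `d' ≥ 1` of columns there is a precoder `V` with `min N_T N_R`
columns producing the same transmit covariance through `H` with no more power. -/
theorem stmt_7 (NR NT : ℕ) :
    ∀ (H : Matrix (Fin NR) (Fin NT) ℂ) (d' : ℕ), 1 ≤ d' →
      ∀ V' : Matrix (Fin NT) (Fin d') ℂ,
        ∃ V : Matrix (Fin NT) (Fin (min NT NR)) ℂ,
          H * V * Vᴴ * Hᴴ = H * V' * V'ᴴ * Hᴴ ∧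
          (Matrix.trace (V * Vᴴ)).re ≤ (Matrix.trace (V' * V'ᴴ)).re := by
  intro H d' _ V'
  obtain ⟨r, hr, Q, hQ, hHQ⟩ := Matrix.exists_orthonormal_rowSpace H
  obtain ⟨E, hE⟩ := Matrix.exists_mul_conjTranspose_eq_one hr
  have hA : (Qᴴ * V' * V'ᴴ * Q).PosSemidef := by
    simpa [Matrix.mul_assoc] using posSemidef_self_mul_conjTranspose (Qᴴ * V')
  obtain ⟨B, hB⟩ := hA.exists_eq_mul_conjTranspose
  have hV : Q * B * E * (Q * B * E)ᴴ = Q * (Qᴴ * V' * V'ᴴ * Q) * Qᴴ := by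
    calc Q * B * E * (Q * B * E)ᴴ = Q * B * (E * Eᴴ) * (Bᴴ * Qᴴ) := by
          simp only [conjTranspose_mul, Matrix.mul_assoc]
      _ = Q * (B * Bᴴ) * Qᴴ := by rw [hE, Matrix.mul_one]; simp only [Matrix.mul_assoc]
      _ = Q * (Qᴴ * V' * V'ᴴ * Q) * Qᴴ := by rw [hB]
  have hHQ' : Q * Qᴴ * Hᴴ = Hᴴ := by simpa using congrArg conjTranspose hHQ
  refine ⟨Q * B * E, ?_, ?_⟩
  · calc H * (Q * B * E) * (Q * B * E)ᴴ * Hᴴ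
        = H * (Q * B * E * (Q * B * E)ᴴ) * Hᴴ := by simp only [Matrix.mul_assoc]
      _ = H * (Q * Qᴴ) * (V' * V'ᴴ) * (Q * Qᴴ * Hᴴ) := by rw [hV]; simp only [Matrix.mul_assoc]
      _ = H * V' * V'ᴴ * Hᴴ := by rw [hHQ, hHQ']; simp only [Matrix.mul_assoc]
  · rw [hV]
    exact Matrix.re_trace_compression_le Q hQ V'
end

section
/- Let H ∈ ℂ^{N_R×N_T} be a nonzero matrix, let c ≥ 0, and set d = min(N_T, N_R). Then there exists V ∈ ℂ^{N_T×d} such that log det(I + H V Vᴴ Hᴴ) ≥ c and Re Tr(V Vᴴ) ≤ d (e^c − 1) / Re Tr(H Hᴴ). -/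
open Matrix

lemma trace_mul_conjTranspose_re {m n : Type*} [Fintype m] [Fintype n] (A : Matrix m n ℂ) :
    (trace (A * Aᴴ)).re = ∑ i, ∑ j, Complex.normSq (A i j) := by
  simp [trace, mul_apply, Complex.mul_conj, ← Complex.ofReal_sum]

/-- Some nonzero vector is amplified by `A` at least as much as the average over the columns. -/
lemma exists_amplified_by_columns {m n : Type*} [Fintype m] [Fintype n] (A : Matrix m n ℂ)
    (hA : 0 < ∑ i, ∑ j, Complex.normSq (A i j)) :
    ∃ v : n → ℂ, 0 < ∑ j, Complex.normSq (v j) ∧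
      (∑ i, ∑ j, Complex.normSq (A i j)) * ∑ j, Complex.normSq (v j) ≤
        Fintype.card n * ∑ i, Complex.normSq ((A *ᵥ v) i) := by
  classical
  rw [Finset.sum_comm] at hA ⊢
  have hne : (Finset.univ : Finset n).Nonempty := by
    by_contra h
    rw [Finset.not_nonempty_iff_eq_empty] at h
    simp [h] at hA
  obtain ⟨k, -, hk⟩ := Finset.exists_max_image Finset.univ
    (fun j => ∑ i, Complex.normSq (A i j)) hne
  have hv : ∑ j, Complex.normSq ((Pi.single k 1 : n → ℂ) j) = 1 := by
    rw [Finset.sum_eq_single k] <;> simp +contextual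
  refine ⟨Pi.single k 1, by rw [hv]; exact one_pos, ?_⟩
  rw [hv, mul_one]
  simpa using Finset.sum_le_card_nsmul Finset.univ _ _ hk

/-- Some nonzero vector is amplified by `A` at least as much as the average over the rows. -/
lemma exists_amplified_by_rows {m n : Type*} [Fintype m] [Fintype n] (A : Matrix m n ℂ)
    (hA : 0 < ∑ i, ∑ j, Complex.normSq (A i j)) :
    ∃ v : n → ℂ, 0 < ∑ j, Complex.normSq (v j) ∧
      (∑ i, ∑ j, Complex.normSq (A i j)) * ∑ j, Complex.normSq (v j) ≤
        Fintype.card m * ∑ i, Complex.normSq ((A *ᵥ v) i) := by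
  have hne : (Finset.univ : Finset m).Nonempty := by
    by_contra h
    rw [Finset.not_nonempty_iff_eq_empty] at h
    simp [h] at hA
  obtain ⟨k, -, hk⟩ := Finset.exists_max_image Finset.univ
    (fun i => ∑ j, Complex.normSq (A i j)) hne
  have hsum : ∑ i, ∑ j, Complex.normSq (A i j) ≤
      Fintype.card m * ∑ j, Complex.normSq (A k j) := by
    simpa using Finset.sum_le_card_nsmul Finset.univ _ _ hk
  have hv : ∑ j, Complex.normSq (star (A k) j) = ∑ j, Complex.normSq (A k j) := by simp
  refine ⟨star (A k), ?_, ?_⟩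
  · rw [hv]
    exact pos_of_mul_pos_right (hA.trans_le hsum) (Nat.cast_nonneg _)
  · rw [hv]
    have hAk : (A *ᵥ star (A k)) k = ((∑ j, Complex.normSq (A k j) : ℝ) : ℂ) := by
      simp [mulVec, dotProduct, Complex.mul_conj]
    have hle : (∑ j, Complex.normSq (A k j)) * ∑ j, Complex.normSq (A k j) ≤
        ∑ i, Complex.normSq ((A *ᵥ star (A k)) i) := by
      rw [← Complex.normSq_ofReal, ← hAk]
      exact Finset.single_le_sum (f := fun i => Complex.normSq ((A *ᵥ star (A k)) i))
        (fun i _ => Complex.normSq_nonneg _) (Finset.mem_univ k)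
    calc _ ≤ (Fintype.card m * ∑ j, Complex.normSq (A k j)) * ∑ j, Complex.normSq (A k j) :=
          mul_le_mul_of_nonneg_right hsum (Finset.sum_nonneg fun _ _ => Complex.normSq_nonneg _)
      _ ≤ _ := by
          rw [mul_assoc]
          exact mul_le_mul_of_nonneg_left hle (Nat.cast_nonneg _)

lemma det_one_add_vecMulVec_star_re {m : Type*} [Fintype m] [DecidableEq m] (u : m → ℂ) :
    (1 + vecMulVec u (star u)).det.re = 1 + ∑ i, Complex.normSq (u i) := by
  rw [vecMulVec_eq Unit, det_one_add_replicateCol_mul_replicateRow]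
  simp [dotProduct, ← Complex.normSq_eq_conj_mul_self]

/-- Feasibility power bound: for a nonzero channel `H` and target rate `c` (nats), there is a
precoder `V` with `min N_T N_R` streams achieving `log det(I + H V Vᴴ Hᴴ) ≥ c` with
transmit power at most `d (e^c − 1) / Tr(H Hᴴ)`. -/
theorem stmt_10 (NR NT : ℕ) (H : Matrix (Fin NR) (Fin NT) ℂ) (hH : H ≠ 0)
    (c : ℝ) (hc : 0 ≤ c) :
    ∃ V : Matrix (Fin NT) (Fin (min NT NR)) ℂ,
      Real.log ((1 + H * V * Vᴴ * Hᴴ).det.re) ≥ c ∧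
      (Matrix.trace (V * Vᴴ)).re ≤
        (min NT NR : ℝ) * (Real.exp c - 1) / (Matrix.trace (H * Hᴴ)).re := by
  obtain ⟨i₀, j₀, hij⟩ : ∃ i j, H i j ≠ 0 := by
    by_contra! h
    exact hH (Matrix.ext h)
  have hT : 0 < ∑ i, ∑ j, Complex.normSq (H i j) :=
    Finset.sum_pos' (fun i _ => Finset.sum_nonneg fun j _ => Complex.normSq_nonneg _)
      ⟨i₀, Finset.mem_univ _, Finset.sum_pos' (fun j _ => Complex.normSq_nonneg _)
        ⟨j₀, Finset.mem_univ _, Complex.normSq_pos.2 hij⟩⟩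
  obtain ⟨v, hv, hle⟩ : ∃ v : Fin NT → ℂ, 0 < ∑ j, Complex.normSq (v j) ∧
      (∑ i, ∑ j, Complex.normSq (H i j)) * ∑ j, Complex.normSq (v j) ≤
        (min NT NR : ℝ) * ∑ i, Complex.normSq ((H *ᵥ v) i) := by
    rcases le_total NT NR with h | h
    · rw [min_eq_left (Nat.cast_le.2 h)]
      simpa using exists_amplified_by_columns H hT
    · rw [min_eq_right (Nat.cast_le.2 h)]
      simpa using exists_amplified_by_rows H hT
  have hHv : 0 < ∑ i, Complex.normSq ((H *ᵥ v) i) :=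
    pos_of_mul_pos_right ((mul_pos hT hv).trans_le hle) (by positivity)
  have hexp : 0 ≤ Real.exp c - 1 := sub_nonneg.2 (Real.one_le_exp hc)
  set p : ℝ := (Real.exp c - 1) / ∑ i, Complex.normSq ((H *ᵥ v) i) with hp
  have hp0 : 0 ≤ p := div_nonneg hexp hHv.le
  have hpq : p * ∑ i, Complex.normSq ((H *ᵥ v) i) = Real.exp c - 1 :=
    div_mul_cancel₀ _ hHv.ne'
  set w : Fin NT → ℂ := ((√p : ℝ) : ℂ) • v with hw
  let k : Fin (min NT NR) := ⟨0, lt_min j₀.pos i₀.pos⟩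
  have hVV : vecMulVec w (Pi.single k 1) * (vecMulVec w (Pi.single k 1))ᴴ =
      vecMulVec w (star w) := by
    rw [conjTranspose_vecMulVec, vecMulVec_mul_vecMulVec]
    simp
  refine ⟨vecMulVec w (Pi.single k 1), ?_, ?_⟩
  · rw [Matrix.mul_assoc H, hVV, mul_vecMulVec, vecMulVec_mul, ← star_mulVec,
      det_one_add_vecMulVec_star_re]
    have hHw : ∑ i, Complex.normSq ((H *ᵥ w) i) = Real.exp c - 1 := by
      rw [← hpq, Finset.mul_sum]
      simp [hw, mulVec_smul, Real.mul_self_sqrt hp0]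
    rw [hHw, add_sub_cancel, Real.log_exp]
  · rw [hVV, trace_mul_conjTranspose_re, le_div_iff₀ hT]
    have hwp : (trace (vecMulVec w (star w))).re = p * ∑ j, Complex.normSq (v j) := by
      rw [trace_vecMulVec, Finset.mul_sum]
      simp only [dotProduct, Pi.star_apply, Complex.star_def, Complex.mul_conj, Complex.re_sum,
        Complex.ofReal_re]
      simp [hw, Real.mul_self_sqrt hp0]
    rw [hwp, ← hpq]
    linarith [mul_le_mul_of_nonneg_left hle hp0]
end

section
/- The function ψ : ℝ^L → ℝ defined by ψ(q) = ∫_X [(1 − min_{1≤k≤K} q_{π(x)(k)}) a(x) + (min_{1≤k≤K} q_{π(x)(k)}) b(x)] dμ(x) is convex on ℝ^L. -/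
open MeasureTheory

/-- The minimum of finitely many coordinates is a concave function of the vector. -/
theorem concaveOn_iInf_apply {ι κ : Type*} [Finite κ] [Nonempty κ] (σ : κ → ι) :
    ConcaveOn ℝ Set.univ fun q : ι → ℝ => ⨅ k, q (σ k) := by
  refine ⟨convex_univ, fun p _ q _ s t hs ht _ => le_ciInf fun k => ?_⟩
  have hp : ⨅ k, p (σ k) ≤ p (σ k) := ciInf_le (Set.finite_range _).bddBelow k
  have hq : ⨅ k, q (σ k) ≤ q (σ k) := ciInf_le (Set.finite_range _).bddBelow k
  simp only [Pi.add_apply, Pi.smul_apply, smul_eq_mul]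
  gcongr

/-- Multiplying an integrable function by the minimum of finitely many coordinates, chosen
measurably from a fixed vector, preserves integrability. -/
theorem MeasureTheory.Integrable.iInf_apply_mul {X ι κ : Type*} [MeasurableSpace X] {μ : Measure X}
    [Finite ι] [MeasurableSpace ι] [DiscreteMeasurableSpace ι] [Finite κ] [Nonempty κ]
    {π : X → κ → ι} (hπ : Measurable π) {f : X → ℝ} (hf : Integrable f μ) (q : ι → ℝ) :
    Integrable (fun x => (⨅ k, q (π x k)) * f x) μ := by
  obtain ⟨C, hC⟩ := (Set.finite_range fun i => ‖q i‖).bddAbove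
  have hm : Measurable fun x => ⨅ k, q (π x k) :=
    Measurable.iInf fun k => (Measurable.of_discrete (f := q)).comp (measurable_pi_iff.1 hπ k)
  refine hf.bdd_mul (c := C) hm.aestronglyMeasurable (.of_forall fun x => ?_)
  obtain ⟨k, hk⟩ := exists_eq_ciInf_of_finite (f := fun k => q (π x k))
  rw [← hk]
  exact hC ⟨π x k, rfl⟩

/-- Hidden convexity of the long-term cache control objective:
`ψ(q) = ∫ (1 − min_k q_{π(x)(k)}) a(x) + (min_k q_{π(x)(k)}) b(x) dμ(x)` is convex in `q`,
where `0 ≤ b ≤ a` almost everywhere. -/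
theorem stmt_12 {X : Type*} [MeasurableSpace X] (μ : Measure X) [IsProbabilityMeasure μ]
    (K L : ℕ) (hK : 1 ≤ K) (hL : 1 ≤ L)
    (π : X → Fin K → Fin L) (hπ : Measurable π)
    (a b : X → ℝ) (ha : Integrable a μ) (hb : Integrable b μ)
    (hab : ∀ᵐ x ∂μ, 0 ≤ b x ∧ b x ≤ a x)
    (ψ : (Fin L → ℝ) → ℝ)
    (hψ : ∀ q : Fin L → ℝ,
      ψ q = ∫ x, ((1 - ⨅ k, q (π x k)) * a x + (⨅ k, q (π x k)) * b x) ∂μ) :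
    ConvexOn ℝ Set.univ ψ := by
  have : Nonempty (Fin K) := ⟨⟨0, hK⟩⟩
  have hint (q : Fin L → ℝ) :
      Integrable (fun x => (1 - ⨅ k, q (π x k)) * a x + (⨅ k, q (π x k)) * b x) μ := by
    simp only [sub_mul, one_mul]
    exact (ha.sub (ha.iInf_apply_mul hπ q)).add (hb.iInf_apply_mul hπ q)
  refine ⟨convex_univ, fun p _ q _ s t hs ht hst => ?_⟩
  simp only [hψ, smul_eq_mul]
  rw [← integral_const_mul, ← integral_const_mul,
    ← integral_add ((hint p).const_mul s) ((hint q).const_mul t)]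
  refine integral_mono_ae (hint _) (((hint p).const_mul s).add ((hint q).const_mul t)) ?_
  filter_upwards [hab] with x hx
  have hmin := (concaveOn_iInf_apply (π x)).2 (Set.mem_univ p) (Set.mem_univ q) hs ht hst
  simp only [smul_eq_mul] at hmin
  have hmul := mul_le_mul_of_nonneg_right hmin (sub_nonneg.2 hx.2)
  linear_combination hmul - a x * hst
end

section
/- Fix q ∈ ℝ^L and a measurable map k* : X → {1,...,K} with q_{π(x)(k*(x))} = min_{1≤k≤K} q_{π(x)(k)} for every x. Define g : X → ℝ^L by g(x)_l = b(x) − a(x) if l = π(x)(k*(x)) and g(x)_l = 0 otherwise. Then for every q' ∈ ℝ^L, ψ(q') ≥ ψ(q) + Σ_{l=1}^L (∫_X g(x)_l dμ(x)) (q'_l − q_l); that is, ∫ g dμ is a subgradient of ψ at q. -/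
open MeasureTheory

/-- Multiplying an integrable function by a function of a finitely valued measurable map
preserves integrability. -/
theorem MeasureTheory.Integrable.finite_range_mul {X S : Type*} [MeasurableSpace X]
    [MeasurableSpace S] [MeasurableSingletonClass S] [Finite S] {μ : Measure X} {h : X → ℝ}
    (hh : Integrable h μ) {T : X → S} (hT : Measurable T) (F : S → ℝ) :
    Integrable (fun x => F (T x) * h x) μ := by
  obtain ⟨C, hC⟩ := (Set.finite_range fun s => ‖F s‖).bddAbove
  exact hh.bdd_mul ((measurable_of_finite F).comp hT).aestronglyMeasurable
    (.of_forall fun x => hC ⟨T x, rfl⟩)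

/-- The expectation of the random vector `g(x)` — which has entry `b(x) − a(x)` in
coordinate `π(x)(k*(x))` (a minimizing coordinate) and zeros elsewhere — is an unbiased
subgradient of the long-term cache control objective `ψ` at `q`. -/
theorem stmt_14 {X : Type*} [MeasurableSpace X] (μ : Measure X) [IsProbabilityMeasure μ]
    (K L : ℕ) (hK : 1 ≤ K) (hL : 1 ≤ L)
    (π : X → Fin K → Fin L) (hπ : Measurable π)
    (a b : X → ℝ) (ha : Integrable a μ) (hb : Integrable b μ)
    (hab : ∀ᵐ x ∂μ, 0 ≤ b x ∧ b x ≤ a x)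
    (ψ : (Fin L → ℝ) → ℝ)
    (hψ : ∀ p : Fin L → ℝ,
      ψ p = ∫ x, ((1 - ⨅ k, p (π x k)) * a x + (⨅ k, p (π x k)) * b x) ∂μ)
    (q : Fin L → ℝ) (kstar : X → Fin K) (hkstar_meas : Measurable kstar)
    (hkstar : ∀ x, q (π x (kstar x)) = ⨅ k, q (π x k))
    (g : X → Fin L → ℝ)
    (hg : ∀ x l, g x l = if l = π x (kstar x) then b x - a x else 0) :
    ∀ q' : Fin L → ℝ, ψ q' ≥ ψ q + ∑ l, (∫ x, g x l ∂μ) * (q' l - q l) := by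
  intro q'
  have hba : Integrable (fun x => b x - a x) μ := hb.sub ha
  have hobj (p : Fin L → ℝ) :
      Integrable (fun x => (1 - ⨅ k, p (π x k)) * a x + (⨅ k, p (π x k)) * b x) μ :=
    (ha.finite_range_mul hπ (fun σ => 1 - ⨅ k, p (σ k))).add
      (hb.finite_range_mul hπ (fun σ => ⨅ k, p (σ k)))
  have hgint (l : Fin L) : Integrable (fun x => g x l) μ := by
    refine (hba.finite_range_mul (hπ.prodMk hkstar_meas)
      (fun z => if l = z.1 z.2 then 1 else 0)).congr (.of_forall fun x => ?_)
    simp [hg]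
  have hsum : Integrable (fun x => ∑ l, g x l * (q' l - q l)) μ :=
    integrable_finsetSum _ fun l _ => (hgint l).mul_const _
  have hlin : ∑ l, (∫ x, g x l ∂μ) * (q' l - q l) = ∫ x, ∑ l, g x l * (q' l - q l) ∂μ := by
    rw [integral_finsetSum _ fun l _ => (hgint l).mul_const _]
    simp only [integral_mul_const]
  rw [ge_iff_le, hψ, hψ, hlin, ← integral_add (hobj q) hsum]
  refine integral_mono_ae ((hobj q).add hsum) (hobj q') ?_
  filter_upwards [hab] with x hx
  have hmin : ⨅ k, q' (π x k) ≤ q' (π x (kstar x)) := ciInf_le (Set.finite_range _).bddBelow _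
  simp only [hg, ite_mul, zero_mul, Finset.sum_ite_eq', Finset.mem_univ, if_true, ← hkstar x]
  nlinarith [mul_nonneg (sub_nonneg.2 hx.2) (sub_nonneg.2 hmin)]
end
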